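/- Let $m,n\ge 1$ and let $P(z)=z^nI+P_1z^{n-1}+\cdots+P_n$, $P_k\in\mathrm{Mat}_m(\mathbb C)$, be a monic $m\times m$ matrix polynomial of degree $n$ whose determinant $\det P(z)$ has $mn$ pairwise distinct roots. Then the eigenvectors of $P(z)$, i.e. the nonzero vectors $v\in\mathbb C^m$ with $P(\lambda)v=0$ for some root $\lambda$ of $\det P(z)$, span $\mathbb C^m$; in particular, there exist $m$ pairwise distinct roots $\lambda_1,\dots,\lambda_m$ of $\det P(z)$ and vectors $v_1,\dots,v_m$ forming a basis of $\mathbb C^m$ with $P(\lambda_i)v_i=0$ for each $i$. -/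

import Mathlib

/-- The monic matrix polynomial `zⁿ I + P₁ zⁿ⁻¹ + ⋯ + Pₙ`, as a matrix with polynomial entries.
The coefficient `P_{k+1}` is `A k` for `k = 0, …, n - 1`. -/
noncomputable def monicMatrixPoly {m n : ℕ} (A : Fin n → Matrix (Fin m) (Fin m) ℂ) :
    Matrix (Fin m) (Fin m) (Polynomial ℂ) :=
  (Polynomial.X ^ n : Polynomial ℂ) • (1 : Matrix (Fin m) (Fin m) (Polynomial ℂ)) +
    ∑ k : Fin n, (Polynomial.X ^ (n - (k.val + 1)) : Polynomial ℂ) • (A k).map Polynomial.C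

/-- The value `P(lam)` of a matrix polynomial at a complex number. -/
noncomputable def matrixPolyEval {m : ℕ} (P : Matrix (Fin m) (Fin m) (Polynomial ℂ)) (lam : ℂ) :
    Matrix (Fin m) (Fin m) ℂ :=
  P.map (Polynomial.eval lam)

/-- `lam` is an eigenvalue of `P`: a root of `det P(z)`. -/
def IsMatrixPolyEigenvalue {m : ℕ} (P : Matrix (Fin m) (Fin m) (Polynomial ℂ)) (lam : ℂ) : Prop :=
  P.det.IsRoot lam

/-- `v` is an eigenvector of `P` for the eigenvalue `lam`. -/
def IsMatrixPolyEigenvector {m : ℕ} (P : Matrix (Fin m) (Fin m) (Polynomial ℂ)) (lam : ℂ)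
    (v : Fin m → ℂ) : Prop :=
  IsMatrixPolyEigenvalue P lam ∧ v ≠ 0 ∧ (matrixPolyEval P lam).mulVec v = 0

open Polynomial in
/-- A determinant of size `k` with entries of degree at most `d` has degree at most `k * d`. -/
theorem Matrix.natDegree_det_le_mul {R : Type*} [CommRing R] {k d : ℕ}
    (M : Matrix (Fin k) (Fin k) R[X]) (h : ∀ i j, (M i j).natDegree ≤ d) :
    M.det.natDegree ≤ k * d := by
  rw [Matrix.det_apply]
  refine natDegree_sum_le_of_forall_le _ _ fun σ _ => ?_
  refine (natDegree_smul_le _ _).trans ((natDegree_prod_le _ _).trans ?_)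
  exact (Finset.sum_le_sum fun i _ => h (σ i) i).trans (by simp)

open Polynomial in
/-- The entries of the adjugate of a matrix of size `k + 1` with entries of degree at most `d`
have degree at most `k * d`. -/
theorem Matrix.natDegree_adjugate_le_mul {R : Type*} [CommRing R] {k d : ℕ}
    (M : Matrix (Fin (k + 1)) (Fin (k + 1)) R[X]) (h : ∀ i j, (M i j).natDegree ≤ d)
    (i j : Fin (k + 1)) : (M.adjugate i j).natDegree ≤ k * d := by
  rw [Matrix.adjugate_fin_succ_eq_det_submatrix]
  have hsign : ((-1 : R[X]) ^ (j + i : ℕ)) = C ((-1 : R) ^ (j + i : ℕ)) := by simp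
  rw [hsign]
  exact (natDegree_C_mul_le _ _).trans (natDegree_det_le_mul _ fun a b => h _ _)

/-- If the `(i, j)` entry of the adjugate is nonzero, a kernel vector is determined by its
`i`-th coordinate. -/
theorem Matrix.eq_zero_of_mulVec_eq_zero_of_adjugate_ne_zero {K ι : Type*} [Field K] [Fintype ι]
    [DecidableEq ι] {M : Matrix ι ι K} {i j : ι} (hij : M.adjugate i j ≠ 0) {v : ι → K}
    (hv : M.mulVec v = 0) (hi : v i = 0) : v = 0 := by
  by_contra hne
  refine hij ?_
  rw [Matrix.adjugate_apply]
  refine Matrix.exists_mulVec_eq_zero_iff.mp ⟨v, hne, ?_⟩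
  ext a
  by_cases ha : a = j
  · subst ha
    simp [Matrix.mulVec, hi]
  · simpa [Matrix.mulVec, Matrix.updateRow_ne ha] using congrFun hv a

/-- A singular matrix has a nonzero kernel vector that spans all columns of the adjugate. -/
theorem Matrix.exists_mulVec_eq_zero_and_adjugate_mulVec_mem_span {K ι : Type*} [Field K]
    [Fintype ι] [DecidableEq ι] {M : Matrix ι ι K} (hM : M.det = 0) :
    ∃ v : ι → K, v ≠ 0 ∧ M.mulVec v = 0 ∧
      ∀ w, M.adjugate.mulVec w ∈ Submodule.span K {v} := by
  have hker (w : ι → K) : M.mulVec (M.adjugate.mulVec w) = 0 := by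
    simp [Matrix.mulVec_mulVec, Matrix.mul_adjugate, hM]
  obtain ⟨v, hv0, hv⟩ := Matrix.exists_mulVec_eq_zero_iff.mpr hM
  refine ⟨v, hv0, hv, fun w => ?_⟩
  by_cases hadj : M.adjugate = 0
  · simp [hadj]
  obtain ⟨i, j, hij⟩ : ∃ i j, M.adjugate i j ≠ 0 := by
    by_contra! h
    exact hadj (Matrix.ext h)
  have hvi : v i ≠ 0 := fun h =>
    hv0 (eq_zero_of_mulVec_eq_zero_of_adjugate_ne_zero hij hv h)
  set u := M.adjugate.mulVec w with hu
  have hzero : u - (u i / v i) • v = 0 := by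
    refine eq_zero_of_mulVec_eq_zero_of_adjugate_ne_zero hij ?_ ?_
    · rw [Matrix.mulVec_sub, Matrix.mulVec_smul, hv, hu, hker]
      simp
    · simp [hvi]
  exact Submodule.mem_span_singleton.mpr ⟨_, (sub_eq_zero.mp hzero).symm⟩

open Polynomial in
/-- Suppose `M` has size `k + 1`, entries of degree at most `d` and `det M ≠ 0`, and `S` has more
than `k * d` elements. A vector orthogonal to the columns of all `adj M(z)`, `z ∈ S`, is zero. -/
theorem Matrix.eq_zero_of_vecMul_adjugate_eval_eq_zero {K : Type*} [Field K] {k d : ℕ}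
    {M : Matrix (Fin (k + 1)) (Fin (k + 1)) K[X]} (hdeg : ∀ i j, (M i j).natDegree ≤ d)
    (hdet : M.det ≠ 0) {S : Finset K} (hS : k * d < S.card) {c : Fin (k + 1) → K}
    (hc : ∀ z ∈ S, Matrix.vecMul c (M.map (eval z)).adjugate = 0) : c = 0 := by
  have hadj (z : K) : (M.map (eval z)).adjugate = M.adjugate.map (eval z) :=
    ((evalRingHom z).map_adjugate M).symm
  have hvec : Matrix.vecMul (fun i => C (c i)) M.adjugate = 0 := by
    ext1 j
    refine eq_zero_of_natDegree_lt_card_of_eval_eq_zero' _ S (fun z hz => ?_) (lt_of_le_of_lt ?_ hS)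
    · have h := congrFun (hc z hz) j
      rw [hadj] at h
      simpa [Matrix.vecMul, dotProduct, eval_finsetSum] using h
    · simp only [Matrix.vecMul, dotProduct]
      refine natDegree_sum_le_of_forall_le _ _ fun i _ => ?_
      exact (natDegree_C_mul_le _ _).trans (natDegree_adjugate_le_mul M hdeg i j)
  have hmul : Matrix.vecMul (fun i => C (c i)) (M.adjugate * M) = 0 := by
    rw [← Matrix.vecMul_vecMul, hvec, Matrix.zero_vecMul]
  ext i
  have h := congrFun hmul i
  simpa [Matrix.adjugate_mul, Matrix.vecMul_smul, hdet] using h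

theorem natDegree_monicMatrixPoly_le {m n : ℕ} (A : Fin n → Matrix (Fin m) (Fin m) ℂ)
    (i j : Fin m) : (monicMatrixPoly A i j).natDegree ≤ n := by
  simp only [monicMatrixPoly, Matrix.add_apply, Matrix.sum_apply, Matrix.smul_apply, smul_eq_mul,
    Matrix.map_apply]
  refine Polynomial.natDegree_add_le_of_degree_le ?_
    (Polynomial.natDegree_sum_le_of_forall_le _ _ fun k _ => ?_)
  · by_cases h : i = j
    · simp [Matrix.one_apply, h]
    · simp [h]
  · exact (Polynomial.natDegree_mul_C_le _ _).trans (by simp)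

theorem det_matrixPolyEval {m : ℕ} (P : Matrix (Fin m) (Fin m) (Polynomial ℂ)) (z : ℂ) :
    (matrixPolyEval P z).det = P.det.eval z :=
  ((Polynomial.evalRingHom z).map_det P).symm

/-- If `det P` has `m * n` distinct roots, then any choice of one vector per root whose span
contains the columns of `adj P(z)` spans `ℂᵐ`. -/
theorem span_range_eq_top_of_adjugate_mem_span {m n : ℕ} (hn : 1 ≤ n)
    {P : Matrix (Fin m) (Fin m) (Polynomial ℂ)} (hdeg : ∀ i j, (P i j).natDegree ≤ n)
    (hroots : {z : ℂ | P.det.IsRoot z}.ncard = m * n)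
    (v : {z : ℂ | P.det.IsRoot z} → Fin m → ℂ)
    (hv : ∀ z w, (matrixPolyEval P z).adjugate.mulVec w ∈ Submodule.span ℂ {v z}) :
    Submodule.span ℂ (Set.range v) = ⊤ := by
  obtain _ | k := m
  · exact Subsingleton.elim _ _
  have hpos : 0 < {z : ℂ | P.det.IsRoot z}.ncard := hroots ▸ by positivity
  have hfin := Set.finite_of_ncard_pos hpos
  have hdet : P.det ≠ 0 := by
    intro h
    refine Set.infinite_univ (α := ℂ) (hfin.subset fun z _ => ?_)
    simp [h]
  by_contra hspan
  obtain ⟨f, hf0, hf⟩ := Submodule.exists_le_ker_of_lt_top _ (lt_top_iff_ne_top.mpr hspan)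
  obtain ⟨c, rfl⟩ := (dotProductEquiv ℂ (Fin (k + 1))).surjective f
  refine hf0 ?_
  rw [Matrix.eq_zero_of_vecMul_adjugate_eval_eq_zero (c := c) (S := hfin.toFinset) hdeg hdet,
    map_zero]
  · rw [← Set.ncard_eq_toFinset_card _ hfin, hroots]
    exact Nat.mul_lt_mul_of_pos_right k.lt_succ_self hn
  · intro z hz
    have hz' : z ∈ {z : ℂ | P.det.IsRoot z} := hfin.mem_toFinset.mp hz
    refine dotProduct_eq_zero _ fun w => ?_
    rw [← Matrix.dotProduct_mulVec]
    have hle : Submodule.span ℂ {v ⟨z, hz'⟩} ≤ Submodule.span ℂ (Set.range v) :=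
      Submodule.span_mono (by simp)
    exact hf (hle (hv ⟨z, hz'⟩ w))

theorem eigenvectors_span_of_distinct_roots
    (m n : ℕ) (hn : 1 ≤ n) (A : Fin n → Matrix (Fin m) (Fin m) ℂ)
    (hroots : {z : ℂ | (monicMatrixPoly A).det.IsRoot z}.ncard = m * n) :
    Submodule.span ℂ {v : Fin m → ℂ | ∃ lam : ℂ,
        IsMatrixPolyEigenvector (monicMatrixPoly A) lam v} = ⊤ ∧
    ∃ (lam : Fin m → ℂ) (v : Module.Basis (Fin m) ℂ (Fin m → ℂ)),
      Function.Injective lam ∧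
      (∀ i, IsMatrixPolyEigenvalue (monicMatrixPoly A) (lam i)) ∧
      ∀ i, (matrixPolyEval (monicMatrixPoly A) (lam i)).mulVec (v i) = 0 := by
  set P := monicMatrixPoly A
  have hex (z : {z : ℂ | P.det.IsRoot z}) :=
    Matrix.exists_mulVec_eq_zero_and_adjugate_mulVec_mem_span
      ((det_matrixPolyEval P z).trans z.2)
  choose v hv0 hv hadj using hex
  have htop := span_range_eq_top_of_adjugate_mem_span hn (natDegree_monicMatrixPoly_le A) hroots
    v hadj
  constructor
  · rw [eq_top_iff, ← htop]
    refine Submodule.span_mono ?_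
    rintro _ ⟨z, rfl⟩
    exact ⟨z, z.2, hv0 z, hv z⟩
  · obtain ⟨κ, a, ha, hspan, hli⟩ := exists_linearIndependent' ℂ v
    let b := Module.Basis.mk hli (hspan.trans htop).ge
    let e := b.indexEquiv (Pi.basisFun ℂ (Fin m))
    refine ⟨fun i => a (e.symm i), b.reindex e,
      Subtype.val_injective.comp (ha.comp e.symm.injective), fun i => (a (e.symm i)).2, fun i => ?_⟩
    simpa [b] using hv (a (e.symm i))
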